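/- Let n ≥ 1, let α ∈ (0,1), and let S_1, …, S_{n+1} be exchangeable real-valued random variables that are almost surely pairwise distinct. Let Q := Q(1−α, {S_1, …, S_n} ∪ {+∞}). Then P[S_{n+1} ≤ Q] = ⌈(n+1)(1−α)⌉ / (n+1), and in particular this probability is at least 1−α. -/

import Mathlib

open MeasureTheory

/-- The empirical `(1-α)`-quantile of a finite multiset of extended reals. -/
noncomputable def empQuantile (α : ℝ) (S : Multiset EReal) : EReal :=
  sInf {q : EReal | 1 - α ≤ ((S.filter (fun s => s ≤ q)).card : ℝ) / (S.card : ℝ)}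

/-- The number of entries of `v` strictly below the `i`-th one. -/
noncomputable def strictRank {m : ℕ} (v : Fin m → ℝ) (i : Fin m) : ℕ :=
  ∑ j, if v j < v i then 1 else 0

theorem strictRank_eq_card {m : ℕ} (v : Fin m → ℝ) (i : Fin m) :
    strictRank v i = (Finset.univ.filter fun j => v j < v i).card := by
  simp [strictRank]

theorem strictRank_lt {m : ℕ} (v : Fin m → ℝ) (i : Fin m) : strictRank v i < m := by
  rw [strictRank_eq_card]
  have h : (Finset.univ.filter fun j => v j < v i).card < (Finset.univ : Finset (Fin m)).card :=
    Finset.card_lt_card (Finset.filter_ssubset.2 ⟨i, Finset.mem_univ i, lt_irrefl _⟩)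
  simpa using h

theorem strictRank_lt_strictRank {m : ℕ} {v : Fin m → ℝ} {i j : Fin m} (h : v i < v j) :
    strictRank v i < strictRank v j := by
  simp only [strictRank_eq_card]
  refine Finset.card_lt_card (Finset.ssubset_iff_of_subset ?_ |>.2 ⟨i, by simpa using h, by simp⟩)
  intro l hl
  simp only [Finset.mem_filter, Finset.mem_univ, true_and] at hl ⊢
  exact hl.trans h

theorem strictRank_injective {m : ℕ} {v : Fin m → ℝ} (hv : Function.Injective v) :
    Function.Injective (strictRank v) := by
  intro i j hij
  by_contra hne
  rcases lt_or_gt_of_ne (hv.ne hne) with h | h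
  · exact (strictRank_lt_strictRank h).ne hij
  · exact (strictRank_lt_strictRank h).ne' hij

theorem card_strictRank_lt {m : ℕ} {v : Fin m → ℝ} (hv : Function.Injective v) {k : ℕ}
    (hk : k ≤ m) : (Finset.univ.filter fun i => strictRank v i < k).card = k := by
  have himage : Finset.univ.image (strictRank v) = Finset.range m := by
    refine Finset.eq_of_subset_of_card_le (fun a ha => ?_) ?_
    · obtain ⟨i, -, rfl⟩ := Finset.mem_image.1 ha
      exact Finset.mem_range.2 (strictRank_lt v i)
    · rw [Finset.card_image_of_injective _ (strictRank_injective hv)]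
      simp
  rw [← Finset.card_image_of_injective _ (strictRank_injective hv),
    ← Finset.filter_image (p := fun a => a < k), himage]
  have : (Finset.range m).filter (fun a => a < k) = Finset.range k := by
    ext a
    simp only [Finset.mem_filter, Finset.mem_range]
    omega
  rw [this, Finset.card_range]

theorem strictRank_comp_perm {m : ℕ} (v : Fin m → ℝ) (σ : Equiv.Perm (Fin m)) (i : Fin m) :
    strictRank (fun j => v (σ j)) i = strictRank v (σ i) :=
  Equiv.sum_comp σ fun j => if v j < v (σ i) then 1 else 0

theorem measurable_strictRank {m : ℕ} (i : Fin m) :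
    Measurable fun v : Fin m → ℝ => strictRank v i := by
  unfold strictRank
  exact Finset.measurable_sum _ fun j _ => Measurable.ite
    (measurableSet_lt (measurable_pi_apply j) (measurable_pi_apply i))
    measurable_const measurable_const

/-- A real number lies below the empirical quantile of `v_1, …, v_n, +∞` exactly when fewer than
`⌈(n+1)(1-α)⌉` of the `v_i` lie strictly below it. -/
theorem le_empQuantile_iff {n : ℕ} (α : ℝ) (hα : α < 1) (v : Fin n → ℝ) (x : ℝ) :
    (x : EReal) ≤ empQuantile α ((Finset.univ.val.map fun i => ((v i : ℝ) : EReal)) + {⊤}) ↔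
      (Finset.univ.filter fun i => v i < x).card < ⌈((n : ℝ) + 1) * (1 - α)⌉₊ := by
  have hpos : (0 : ℝ) < (n : ℝ) + 1 := by positivity
  have hcard (q : EReal) (hq : q < ⊤) :
      (((Finset.univ.val.map fun i => ((v i : ℝ) : EReal)) + {⊤}).filter (fun s => s ≤ q)).card =
        (Finset.univ.filter fun i => (v i : EReal) ≤ q).card := by
    rw [Multiset.filter_add, Multiset.filter_singleton, if_neg hq.not_ge, Multiset.filter_map]
    simp [Finset.card_def]
  have htotal : ((((Finset.univ.val.map fun i => ((v i : ℝ) : EReal)) + {⊤}).card : ℕ) : ℝ) =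
      (n : ℝ) + 1 := by
    simp
  rw [Nat.lt_ceil, empQuantile, le_sInf_iff]
  simp only [Set.mem_ofPred_eq, htotal, le_div_iff₀ hpos, mul_comm (1 - α)]
  constructor
  · intro h
    by_contra! hcon
    obtain ⟨i₀, hi₀, hmax⟩ : ∃ i₀ ∈ Finset.univ.filter (fun i => v i < x),
        ∀ i ∈ Finset.univ.filter (fun i => v i < x), v i ≤ v i₀ := by
      refine Finset.exists_max_image _ _ (Finset.card_pos.1 ?_)
      have : 0 < ((n : ℝ) + 1) * (1 - α) := mul_pos hpos (by linarith)
      exact_mod_cast this.trans_le hcon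
    have hle := h (v i₀) (by
      rw [hcard _ (EReal.coe_lt_top _)]
      refine hcon.trans (Nat.cast_le.2 (Finset.card_le_card fun i hi => ?_))
      simpa using hmax i hi)
    have hlt : v i₀ < x := by simpa using hi₀
    exact (EReal.coe_le_coe_iff.1 hle).not_gt hlt
  · intro h q hq
    by_contra! hqx
    rw [hcard q (hqx.trans (EReal.coe_lt_top x))] at hq
    refine (hq.trans (Nat.cast_le.2 (Finset.card_le_card fun i hi => ?_))).not_gt h
    simp only [Finset.mem_filter, Finset.mem_univ, true_and] at hi ⊢
    exact EReal.coe_lt_coe_iff.1 (hi.trans_lt hqx)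

theorem strictRank_last {n : ℕ} (v : Fin (n + 1) → ℝ) :
    strictRank v (Fin.last n) =
      (Finset.univ.filter fun i : Fin n => v i.castSucc < v (Fin.last n)).card := by
  rw [strictRank, Fin.sum_univ_castSucc]
  simp

/-- Ranks of exchangeable, almost surely distinct random variables are uniform. -/
theorem measure_strictRank_lt {Ω : Type*} [MeasurableSpace Ω] (P : Measure Ω)
    [IsProbabilityMeasure P] {m : ℕ} (S : Fin m → Ω → ℝ) (hmeas : ∀ i, Measurable (S i))
    (hexch : ∀ σ : Equiv.Perm (Fin m),
      Measure.map (fun ω => fun i => S (σ i) ω) P = Measure.map (fun ω => fun i => S i ω) P)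
    (hdist : ∀ᵐ ω ∂P, ∀ i j : Fin m, i ≠ j → S i ω ≠ S j ω) {k : ℕ} (hk : k ≤ m) (i : Fin m) :
    P {ω | strictRank (fun j => S j ω) i < k} = ENNReal.ofReal ((k : ℝ) / m) := by
  have hS : Measurable fun ω => fun j => S j ω := measurable_pi_lambda _ hmeas
  have hB (l : Fin m) : MeasurableSet {v : Fin m → ℝ | strictRank v l < k} :=
    measurableSet_lt (measurable_strictRank l) measurable_const
  have hA (l : Fin m) : MeasurableSet {ω | strictRank (fun j => S j ω) l < k} := hS (hB l)
  have hsymm (l : Fin m) : P {ω | strictRank (fun j => S j ω) l < k} =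
      P {ω | strictRank (fun j => S j ω) i < k} := by
    have h := congrArg (fun μ => μ {v : Fin m → ℝ | strictRank v i < k}) (hexch (Equiv.swap i l))
    beta_reduce at h
    rw [Measure.map_apply (measurable_pi_lambda _ fun j => hmeas _) (hB i),
      Measure.map_apply hS (hB i)] at h
    rw [← Set.preimage_ofPred_eq (p := fun v => strictRank v i < k), ← h]
    congr 1
    ext ω
    simp only [Set.mem_preimage, Set.mem_ofPred_eq]
    rw [strictRank_comp_perm (fun j => S j ω), Equiv.swap_apply_left]
  have hsum : ∑ l, P {ω | strictRank (fun j => S j ω) l < k} = k := by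
    calc ∑ l, P {ω | strictRank (fun j => S j ω) l < k}
        = ∑ l, ∫⁻ ω, {ω | strictRank (fun j => S j ω) l < k}.indicator 1 ω ∂P := by
          simp only [lintegral_indicator_one (hA _)]
      _ = ∫⁻ ω, ∑ l, {ω | strictRank (fun j => S j ω) l < k}.indicator 1 ω ∂P :=
          (lintegral_finsetSum _ fun l _ => measurable_one.indicator (hA l)).symm
      _ = ∫⁻ _, (k : ENNReal) ∂P := by
          refine lintegral_congr_ae ?_
          filter_upwards [hdist] with ω hω
          have hinj : Function.Injective fun j => S j ω := fun a b hab =>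
            by_contra fun hne => hω a b hne hab
          simp only [Set.indicator_apply, Set.mem_ofPred_eq, Pi.one_apply, Finset.sum_boole]
          rw [card_strictRank_lt hinj hk]
      _ = k := by simp
  have hm : 0 < m := i.pos
  simp only [hsymm, Finset.sum_const, Finset.card_univ, Fintype.card_fin, nsmul_eq_mul] at hsum
  rw [ENNReal.ofReal_div_of_pos (by exact_mod_cast hm), ENNReal.ofReal_natCast,
    ENNReal.ofReal_natCast, ENNReal.eq_div_iff (by exact_mod_cast hm.ne')
      (ENNReal.natCast_ne_top m), hsum]

/-- Exact coverage of split conformal prediction: for exchangeable, almost surely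
pairwise distinct scores `S_1, …, S_{n+1}`,
`P[S_{n+1} ≤ Q(1-α, {S_1,…,S_n} ∪ {+∞})] = ⌈(n+1)(1-α)⌉/(n+1) ≥ 1-α`. -/
theorem stmt_1 {Ω : Type*} [MeasurableSpace Ω] (P : Measure Ω) [IsProbabilityMeasure P]
    (n : ℕ) (hn : 1 ≤ n) (α : ℝ) (hα : α ∈ Set.Ioo (0 : ℝ) 1)
    (S : Fin (n + 1) → Ω → ℝ) (hmeas : ∀ i, Measurable (S i))
    (hexch : ∀ σ : Equiv.Perm (Fin (n + 1)),
      Measure.map (fun ω => fun i => S (σ i) ω) P = Measure.map (fun ω => fun i => S i ω) P)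
    (hdist : ∀ᵐ ω ∂P, ∀ i j : Fin (n + 1), i ≠ j → S i ω ≠ S j ω) :
    P {ω | (S (Fin.last n) ω : EReal) ≤
        empQuantile α
          ((Finset.univ.val.map fun i : Fin n => ((S i.castSucc ω : ℝ) : EReal)) + {⊤})} =
      ENNReal.ofReal ((⌈((n : ℝ) + 1) * (1 - α)⌉₊ : ℝ) / ((n : ℝ) + 1)) ∧
    ENNReal.ofReal (1 - α) ≤
      P {ω | (S (Fin.last n) ω : EReal) ≤
        empQuantile α
          ((Finset.univ.val.map fun i : Fin n => ((S i.castSucc ω : ℝ) : EReal)) + {⊤})} := by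
  have hevent : {ω | (S (Fin.last n) ω : EReal) ≤
        empQuantile α
          ((Finset.univ.val.map fun i : Fin n => ((S i.castSucc ω : ℝ) : EReal)) + {⊤})} =
      {ω | strictRank (fun j => S j ω) (Fin.last n) < ⌈((n : ℝ) + 1) * (1 - α)⌉₊} := by
    ext ω
    simp only [Set.mem_ofPred_eq]
    rw [le_empQuantile_iff α hα.2 (fun i : Fin n => S i.castSucc ω), strictRank_last]
  have hk : ⌈((n : ℝ) + 1) * (1 - α)⌉₊ ≤ n + 1 := by
    rw [Nat.ceil_le]
    push_cast
    nlinarith [hα.1, (Nat.cast_nonneg n : (0 : ℝ) ≤ n)]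
  have hprob := measure_strictRank_lt P S hmeas hexch hdist hk (Fin.last n)
  push_cast at hprob
  rw [hevent, hprob]
  refine ⟨rfl, ENNReal.ofReal_le_ofReal ?_⟩
  rw [le_div_iff₀ (by positivity), mul_comm]
  exact Nat.le_ceil _
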